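/- For a lattice (L,≤), the following are equivalent: (a) L is a complete lattice; (b) the ball space of principal segments [a,b] (including segments unbounded above or below, and L itself) is S₅; (c) this ball space is S* (the intersection of every centered system of segments is a segment). -/

import Mathlib

/-- The principal segment ball space of a preorder. -/
def principalSegments (L : Type*) [Preorder L] : Set (Set L) :=
  {b : Set L | (∃ a c : L, a ≤ c ∧ b = Set.Icc a c) ∨ (∃ c, b = Set.Iic c) ∨
    (∃ a, b = Set.Ici a) ∨ b = Set.univ}

/-- Every nonempty subset has a supremum and an infimum. -/
def HasSupsInfs (L : Type*) [Preorder L] : Prop :=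
  ∀ S : Set L, S.Nonempty → (∃ s, IsLUB S s) ∧ (∃ i, IsGLB S i)

/-- The intersection of every nonempty chain of members of `B` is in `B`. -/
def ChainIntersectionClosed {X : Type*} (B : Set (Set X)) : Prop :=
  ∀ N ⊆ B, N.Nonempty → IsChain (· ⊆ ·) N → ⋂₀ N ∈ B

/-- The intersection of every nonempty centered system of members of `B` is in `B`. -/
def CenteredIntersectionClosed {X : Type*} (B : Set (Set X)) : Prop :=
  ∀ C ⊆ B, C.Nonempty →
    (∀ F : Finset (Set X), ↑F ⊆ C → F.Nonempty → (⋂₀ (F : Set (Set X))).Nonempty) → ⋂₀ C ∈ B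

theorem nonempty_of_mem_principalSegments {L : Type*} [Preorder L] [Nonempty L] {b : Set L}
    (hb : b ∈ principalSegments L) : b.Nonempty := by
  rcases hb with ⟨a, c, hac, rfl⟩ | ⟨c, rfl⟩ | ⟨a, rfl⟩ | rfl
  · exact Set.nonempty_Icc.2 hac
  · exact Set.nonempty_Iic
  · exact Set.nonempty_Ici
  · exact Set.univ_nonempty

theorem IsChain.exists_mem_subset_sInter_finset {X : Type*} {N : Set (Set X)}
    (hN : IsChain (· ⊆ ·) N) (F : Finset (Set X)) (hF : F.Nonempty) (hFN : ↑F ⊆ N) :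
    ∃ b ∈ N, b ⊆ ⋂₀ (F : Set (Set X)) := by
  obtain ⟨b, hbF, hb⟩ := F.exists_minimal hF
  refine ⟨b, hFN hbF, Set.subset_sInter fun t ht => ?_⟩
  rcases hN.total (hFN hbF) (hFN ht) with h | h
  · exact h
  · exact hb ht h

theorem chainIntersectionClosed_of_centered {L : Type*} [Preorder L]
    (h : CenteredIntersectionClosed (principalSegments L)) :
    ChainIntersectionClosed (principalSegments L) := by
  intro N hN hne hchain
  rcases isEmpty_or_nonempty L with _ | _
  · exact Or.inr (Or.inr (Or.inr (Subsingleton.elim _ _)))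
  refine h N hN hne fun F hFN hF => ?_
  obtain ⟨b, hbN, hb⟩ := hchain.exists_mem_subset_sInter_finset F hF hFN
  exact (nonempty_of_mem_principalSegments (hN hbN)).mono hb

theorem exists_eq_Icc_of_mem_principalSegments {L : Type*} [Preorder L] {b : Set L} {t z : L}
    (ht : IsTop t) (hz : IsBot z) (hb : b ∈ principalSegments L) :
    ∃ a c : L, b = Set.Icc a c := by
  rcases hb with ⟨a, c, -, rfl⟩ | ⟨c, rfl⟩ | ⟨a, rfl⟩ | rfl
  · exact ⟨a, c, rfl⟩
  · exact ⟨z, c, Set.ext fun x => ⟨fun hx => ⟨hz x, hx⟩, And.right⟩⟩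
  · exact ⟨a, t, Set.ext fun x => ⟨fun hx => ⟨hx, ht x⟩, And.left⟩⟩
  · exact ⟨z, t, Set.ext fun x => ⟨fun _ => ⟨hz x, ht x⟩, fun _ => trivial⟩⟩

theorem HasSupsInfs.centeredIntersectionClosed {L : Type*} [Preorder L] (h : HasSupsInfs L) :
    CenteredIntersectionClosed (principalSegments L) := by
  classical
  intro C hC hne hcent
  rcases isEmpty_or_nonempty L with _ | _
  · exact Or.inr (Or.inr (Or.inr (Subsingleton.elim _ _)))
  obtain ⟨⟨t, ht⟩, ⟨z, hz⟩⟩ := h Set.univ Set.univ_nonempty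
  have hIcc : ∀ b : C, ∃ a c : L, (b : Set L) = Set.Icc a c := fun b =>
    exists_eq_Icc_of_mem_principalSegments (fun x => ht.1 (Set.mem_univ x))
      (fun x => hz.1 (Set.mem_univ x)) (hC b.2)
  choose lo hi hlohi using hIcc
  have hle : ∀ b d : C, lo b ≤ hi d := by
    intro b d
    obtain ⟨x, hx⟩ := hcent {(b : Set L), (d : Set L)}
      (by simp [Set.insert_subset_iff]) (by simp)
    have hxb : x ∈ (b : Set L) := hx b (by simp)
    have hxd : x ∈ (d : Set L) := hx d (by simp)
    rw [hlohi] at hxb hxd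
    exact hxb.1.trans hxd.2
  have : Nonempty C := hne.to_subtype
  obtain ⟨a, ha⟩ := (h (Set.range lo) (Set.range_nonempty lo)).1
  obtain ⟨c, hc⟩ := (h (Set.range hi) (Set.range_nonempty hi)).2
  refine Or.inl ⟨a, c, ?_, ?_⟩
  · refine ha.2 ?_
    rintro _ ⟨b, rfl⟩
    refine hc.2 ?_
    rintro _ ⟨d, rfl⟩
    exact hle b d
  · ext x
    have hmem : x ∈ ⋂₀ C ↔ ∀ b : C, lo b ≤ x ∧ x ≤ hi b := by
      simp only [Set.mem_sInter, ← Set.mem_Icc, ← hlohi, Subtype.forall]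
    rw [hmem, forall_and, Set.mem_Icc, isLUB_le_iff ha, le_isGLB_iff hc]
    simp only [mem_upperBounds, mem_lowerBounds, Set.forall_mem_range]

theorem exists_isLUB_of_upperBounds_mem_principalSegments {L : Type*} [Preorder L] {D : Set L}
    (hD : D.Nonempty) (h : upperBounds D ∈ principalSegments L) : ∃ s, IsLUB D s := by
  obtain ⟨d, hd⟩ := hD
  rcases h with ⟨a, c, hac, h⟩ | ⟨c, h⟩ | ⟨a, h⟩ | h
  · exact ⟨a, by rw [IsLUB, h]; exact isLeast_Icc hac⟩
  · have hc : c ∈ upperBounds D := h ▸ Set.self_mem_Iic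
    have hdD : d ∈ upperBounds D := h ▸ hc hd
    exact ⟨d, hdD, fun _ hx => hx hd⟩
  · exact ⟨a, by rw [IsLUB, h]; exact isLeast_Ici⟩
  · have hdD : d ∈ upperBounds D := h ▸ Set.mem_univ d
    exact ⟨d, hdD, fun _ hx => hx hd⟩

theorem ChainIntersectionClosed.exists_isLUB {L : Type*} [Preorder L]
    (h : ChainIntersectionClosed (principalSegments L)) {D : Set L} (hD : D.Nonempty)
    (hchain : IsChain (· ≤ ·) D) : ∃ s, IsLUB D s := by
  refine exists_isLUB_of_upperBounds_mem_principalSegments hD ?_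
  have hInter : upperBounds D = ⋂₀ Set.image Set.Ici D := by
    ext x
    simp [upperBounds]
  rw [hInter]
  refine h _ ?_ (hD.image _) ?_
  · rintro _ ⟨a, -, rfl⟩
    exact Or.inr (Or.inr (Or.inl ⟨a, rfl⟩))
  · rintro _ ⟨a, ha, rfl⟩ _ ⟨b, hb, rfl⟩ -
    exact (hchain.total ha hb).symm.imp Set.Ici_subset_Ici.2 Set.Ici_subset_Ici.2

theorem principalSegments_orderDual (L : Type*) [Preorder L] :
    principalSegments Lᵒᵈ = principalSegments L := by
  ext b
  constructor
  · rintro (⟨a, c, hac, rfl⟩ | ⟨c, rfl⟩ | ⟨a, rfl⟩ | rfl)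
    · exact Or.inl ⟨c, a, hac, Set.ext fun _ => and_comm⟩
    · exact Or.inr (Or.inr (Or.inl ⟨c, rfl⟩))
    · exact Or.inr (Or.inl ⟨a, rfl⟩)
    · exact Or.inr (Or.inr (Or.inr rfl))
  · rintro (⟨a, c, hac, rfl⟩ | ⟨c, rfl⟩ | ⟨a, rfl⟩ | rfl)
    · exact Or.inl ⟨c, a, hac, Set.ext fun _ => and_comm⟩
    · exact Or.inr (Or.inr (Or.inl ⟨c, rfl⟩))
    · exact Or.inr (Or.inl ⟨a, rfl⟩)
    · exact Or.inr (Or.inr (Or.inr rfl))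

theorem ChainIntersectionClosed.orderDual {L : Type*} [Preorder L]
    (h : ChainIntersectionClosed (principalSegments L)) :
    ChainIntersectionClosed (principalSegments Lᵒᵈ) := by
  rw [principalSegments_orderDual]
  exact h

/-- In a join-semilattice in which nonempty chains have suprema, a nonempty set closed under
joins and under suprema of chains has a greatest element. -/
theorem exists_isGreatest_of_chain_closed {L : Type*} [SemilatticeSup L]
    (hsup : ∀ D : Set L, D.Nonempty → IsChain (· ≤ ·) D → ∃ s, IsLUB D s) {U : Set L}
    (hU : U.Nonempty) (hjoin : SupClosed U)
    (hclosed : ∀ D ⊆ U, D.Nonempty → ∀ s, IsLUB D s → s ∈ U) : ∃ m, IsGreatest U m := by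
  obtain ⟨u, hu⟩ := hU
  obtain ⟨m, -, hm⟩ := zorn_le_nonempty₀ U (fun D hDU hD y hy => by
    obtain ⟨s, hs⟩ := hsup D ⟨y, hy⟩ hD
    exact ⟨s, hclosed D hDU ⟨y, hy⟩ s hs, hs.1⟩) u hu
  exact ⟨m, hm.prop, fun x hx =>
    le_sup_right.trans (hm.le_of_ge (hjoin hm.prop hx) le_sup_left)⟩

theorem ChainIntersectionClosed.exists_isBot {L : Type*} [Lattice L] [Nonempty L]
    (h : ChainIntersectionClosed (principalSegments L)) : ∃ z : L, IsBot z := by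
  obtain ⟨z, -, hz⟩ := exists_isGreatest_of_chain_closed (L := Lᵒᵈ)
    (fun _ => h.orderDual.exists_isLUB) (U := Set.univ) Set.univ_nonempty
    (fun _ _ _ _ => Set.mem_univ _) fun _ _ _ _ _ => Set.mem_univ _
  exact ⟨z, fun x => hz (Set.mem_univ x)⟩

theorem ChainIntersectionClosed.exists_isGLB {L : Type*} [Lattice L]
    (h : ChainIntersectionClosed (principalSegments L)) {S : Set L} (hS : S.Nonempty) :
    ∃ i, IsGLB S i := by
  have : Nonempty L := hS.to_type
  obtain ⟨z, hz⟩ := h.exists_isBot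
  exact exists_isGreatest_of_chain_closed (fun _ => h.exists_isLUB) ⟨z, fun x _ => hz x⟩
    (fun _ ha _ hb _ hx => sup_le (ha hx) (hb hx))
    fun _ hD _ _ hs _ hx => hs.2 fun _ hd => hD hd hx

theorem ChainIntersectionClosed.hasSupsInfs {L : Type*} [Lattice L]
    (h : ChainIntersectionClosed (principalSegments L)) : HasSupsInfs L :=
  fun _ hS => ⟨h.orderDual.exists_isGLB hS, h.exists_isGLB hS⟩

/-- For a lattice (L,≤), the following are equivalent: L is a complete lattice;
the principal segment ball space is S₅; the principal segment ball space is S*. -/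
theorem lattice_complete_iff_segments_S5_iff_Sstar {L : Type*} [Lattice L] :
    ((∀ S : Set L, S.Nonempty → (∃ s, IsLUB S s) ∧ (∃ i, IsGLB S i)) ↔
     (∀ N ⊆ {b : Set L | (∃ a c : L, a ≤ c ∧ b = Set.Icc a c) ∨ (∃ c, b = Set.Iic c) ∨
          (∃ a, b = Set.Ici a) ∨ b = Set.univ},
        N.Nonempty → IsChain (· ⊆ ·) N →
        ⋂₀ N ∈ {b : Set L | (∃ a c : L, a ≤ c ∧ b = Set.Icc a c) ∨ (∃ c, b = Set.Iic c) ∨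
          (∃ a, b = Set.Ici a) ∨ b = Set.univ})) ∧
    ((∀ S : Set L, S.Nonempty → (∃ s, IsLUB S s) ∧ (∃ i, IsGLB S i)) ↔
     (∀ C ⊆ {b : Set L | (∃ a c : L, a ≤ c ∧ b = Set.Icc a c) ∨ (∃ c, b = Set.Iic c) ∨
          (∃ a, b = Set.Ici a) ∨ b = Set.univ},
        C.Nonempty →
        (∀ F : Finset (Set L), ↑F ⊆ C → F.Nonempty → (⋂₀ (F : Set (Set L))).Nonempty) →
        ⋂₀ C ∈ {b : Set L | (∃ a c : L, a ≤ c ∧ b = Set.Icc a c) ∨ (∃ c, b = Set.Iic c) ∨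
          (∃ a, b = Set.Ici a) ∨ b = Set.univ})) := by
  exact ⟨⟨fun h => chainIntersectionClosed_of_centered
        (HasSupsInfs.centeredIntersectionClosed h),
      fun h => ChainIntersectionClosed.hasSupsInfs h⟩,
    ⟨fun h => HasSupsInfs.centeredIntersectionClosed h,
      fun h => (chainIntersectionClosed_of_centered h).hasSupsInfs⟩⟩
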